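/- Fischer decomposition for the quaternionic difference Dirac operators: let k ≥ 0 and h > 0. For every P ∈ Π_k^− there exist lattice functions M_0, …, M_k with M_s ∈ Π_{k−s}^− and D_h^{−+} M_s = 0 such that P = Σ_{s=0}^k (mh)^s · M_s; likewise, for every P ∈ Π_k^+ there exist M_s ∈ Π_{k−s}^+ with D_h^{+−} M_s = 0 and P = Σ_{s=0}^k (mh)^s · M_s. Here (mh)^s · M_s is the lattice function m ↦ (mh)^s · M_s(m), the s-th power of the pure quaternion mh acting by pointwise left multiplication. -/

import Mathlib

open Finset Quaternion

noncomputable section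

/-- Forward/backward difference `∂_h^{±l}` on the lattice `ℤ³`. -/
def pd {A : Type*} [AddCommGroup A] [Module ℝ A] (σ : Bool) (h : ℝ) (l : Fin 3)
    (f : (Fin 3 → ℤ) → A) : (Fin 3 → ℤ) → A := fun m =>
  if σ then h⁻¹ • (f (m + Pi.single l 1) - f m) else h⁻¹ • (f m - f (m - Pi.single l 1))

/-- Discrete gradient `grad_h^± φ = (∂_h^{±1}φ, ∂_h^{±2}φ, ∂_h^{±3}φ)`. -/
def grad3 (σ : Bool) (h : ℝ) (φ : (Fin 3 → ℤ) → ℝ) : (Fin 3 → ℤ) → (Fin 3 → ℝ) :=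
  fun m l => pd σ h l φ m

/-- Discrete divergence `div_h^± g = Σ_l ∂_h^{±l} g_l`. -/
def div3 (σ : Bool) (h : ℝ) (g : (Fin 3 → ℤ) → (Fin 3 → ℝ)) : (Fin 3 → ℤ) → ℝ :=
  fun m => ∑ l, pd σ h l (fun m' => g m' l) m

/-- Discrete curl
`curl_h^± g = (∂_h^{±2}g₃ − ∂_h^{±3}g₂, ∂_h^{±3}g₁ − ∂_h^{±1}g₃, ∂_h^{±1}g₂ − ∂_h^{±2}g₁)`. -/
def curl3 (σ : Bool) (h : ℝ) (g : (Fin 3 → ℤ) → (Fin 3 → ℝ)) :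
    (Fin 3 → ℤ) → (Fin 3 → ℝ) := fun m =>
  ![pd σ h 1 (fun m' => g m' 2) m - pd σ h 2 (fun m' => g m' 1) m,
    pd σ h 2 (fun m' => g m' 0) m - pd σ h 0 (fun m' => g m' 2) m,
    pd σ h 0 (fun m' => g m' 1) m - pd σ h 1 (fun m' => g m' 0) m]

/-- The discrete Laplacian `(Δ_h f)(m) = Σ_l (f(m+ε_l) + f(m−ε_l) − 2f(m))/h²`,
acting componentwise. -/
def lap3 {A : Type*} [AddCommGroup A] [Module ℝ A] (h : ℝ) (f : (Fin 3 → ℤ) → A) :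
    (Fin 3 → ℤ) → A := fun m =>
  (h ^ 2)⁻¹ • ∑ l, (f (m + Pi.single l 1) + f (m - Pi.single l 1) - (2 : ℝ) • f m)

/-- The quaternion with real part `r` and vector part `v` (a triple of real lattice values
is identified with the pure quaternion `v₁ i + v₂ j + v₃ k`). -/
def toQ (r : ℝ) (v : Fin 3 → ℝ) : ℍ[ℝ] := ⟨r, v 0, v 1, v 2⟩

/-- The vector part `Vec f = (f¹, f², f³)` of a quaternion-valued lattice function. -/
def vecf (f : (Fin 3 → ℤ) → ℍ[ℝ]) : (Fin 3 → ℤ) → (Fin 3 → ℝ) :=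
  fun m => ![(f m).imI, (f m).imJ, (f m).imK]

/-- The difference Dirac operator `D_h^{−+} f = −div_h^− Vec f + grad_h^− f⁰ + curl_h^+ Vec f`. -/
def Dmp (h : ℝ) (f : (Fin 3 → ℤ) → ℍ[ℝ]) : (Fin 3 → ℤ) → ℍ[ℝ] := fun m =>
  toQ (-(div3 false h (vecf f) m))
    (fun l => grad3 false h (fun m' => (f m').re) m l + curl3 true h (vecf f) m l)

/-- The difference Dirac operator `D_h^{+−} f = −div_h^+ Vec f + grad_h^+ f⁰ + curl_h^− Vec f`. -/
def Dpm (h : ℝ) (f : (Fin 3 → ℤ) → ℍ[ℝ]) : (Fin 3 → ℤ) → ℍ[ℝ] := fun m =>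
  toQ (-(div3 true h (vecf f) m))
    (fun l => grad3 true h (fun m' => (f m').re) m l + curl3 false h (vecf f) m l)

/-- The pure quaternion `mh = (m₁h) i + (m₂h) j + (m₃h) k`. -/
def vecQ3 (h : ℝ) (m : Fin 3 → ℤ) : ℍ[ℝ] :=
  toQ 0 (fun l => (m l : ℝ) * h)

/-- The factorial power `(mh)_+^{(α)}` (for `pos = true`, factors `m_l h + k h`) resp.
`(mh)_−^{(α)}` (for `pos = false`, factors `m_l h − k h`). -/
def mfp3 (pos : Bool) (h : ℝ) (m : Fin 3 → ℤ) (α : Fin 3 → ℕ) : ℝ :=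
  ∏ l, ∏ k ∈ range (α l), ((m l : ℝ) * h + (if pos then 1 else -1) * k * h)

/-- `Π_k`: the real span of the lattice functions `m ↦ (mh)^{(α)} a` with `|α| ≤ k`,
`a ∈ ℍ`.  `Π_k^−` is `PiLe3 true h k` (it uses the `(mh)_+` factorial powers), and
`Π_k^+` is `PiLe3 false h k`. -/
def PiLe3 (pos : Bool) (h : ℝ) (k : ℕ) : Submodule ℝ ((Fin 3 → ℤ) → ℍ[ℝ]) :=
  Submodule.span ℝ {f | ∃ (α : Fin 3 → ℕ) (a : ℍ[ℝ]),
    (∑ l, α l) ≤ k ∧ f = fun m => mfp3 pos h m α • a}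

/-- The real span of the lattice functions `m ↦ (mh)^{(α)} a` with `|α| = k`. -/
def PiEq3 (pos : Bool) (h : ℝ) (k : ℕ) : Submodule ℝ ((Fin 3 → ℤ) → ℍ[ℝ]) :=
  Submodule.span ℝ {f | ∃ (α : Fin 3 → ℕ) (a : ℍ[ℝ]),
    (∑ l, α l) = k ∧ f = fun m => mfp3 pos h m α • a}

/-! ### Fischer decomposition in a filtered module -/

section FilteredModule

variable {V : Type*} [AddCommGroup V] [Module ℝ V]

/-- The scalar `c_s` with `D X^s M = c_s X^{s-1} M` up to lower order terms, for `M` in the kernel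
of `D` and of degree `n`. -/
def fischerCoeff (n : ℕ) : ℕ → ℝ
  | 0 => 0
  | s + 1 => -fischerCoeff n s - (2 * ((n + s : ℕ) : ℝ) + 3)

theorem fischerCoeff_two_mul (n j : ℕ) : fischerCoeff n (2 * j) = -(2 * j) := by
  induction j with
  | zero => simp [fischerCoeff]
  | succ j ih =>
    rw [show 2 * (j + 1) = 2 * j + 1 + 1 by ring]
    simp only [fischerCoeff, ih]
    push_cast
    ring

theorem fischerCoeff_succ_ne_zero (n s : ℕ) : fischerCoeff n (s + 1) ≠ 0 := by
  obtain ⟨j, rfl | rfl⟩ := Nat.even_or_odd' s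
  · simp only [fischerCoeff, fischerCoeff_two_mul]
    have : (0 : ℝ) ≤ n := n.cast_nonneg
    have : (0 : ℝ) ≤ j := j.cast_nonneg
    push_cast
    linarith
  · rw [show 2 * j + 1 + 1 = 2 * (j + 1) by ring, fischerCoeff_two_mul]
    have : (0 : ℝ) ≤ j := j.cast_nonneg
    push_cast
    linarith

variable {F : ℕ → Submodule ℝ V} {X D : V →ₗ[ℝ] V}

theorem pow_mem_filtration (hX : ∀ n, ∀ f ∈ F n, X f ∈ F (n + 1)) {n : ℕ} {f : V} (hf : f ∈ F n)
    (s : ℕ) : (X ^ s) f ∈ F (n + s) := by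
  induction s with
  | zero => simpa using hf
  | succ s ih =>
    rw [pow_succ', Module.End.mul_apply]
    exact hX _ _ ih

theorem apply_pow_sub_mem_filtration (hX : ∀ n, ∀ f ∈ F n, X f ∈ F (n + 1))
    (hrel : ∀ n, ∀ f ∈ F (n + 1), D (X f) + X (D f) + (2 * (n : ℝ) + 3) • f ∈ F n)
    {n : ℕ} {f : V} (hf : f ∈ F (n + 1)) (hDf : D f = 0) (s : ℕ) :
    D ((X ^ (s + 1)) f) - fischerCoeff n (s + 1) • (X ^ s) f ∈ F (n + s) := by
  induction s with
  | zero =>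
    have h := hrel n f hf
    rw [hDf, map_zero, add_zero] at h
    rw [Nat.add_zero]
    convert h using 1
    simp only [fischerCoeff, zero_add, pow_one, pow_zero, Module.End.one_apply, add_zero]
    module
  | succ s ih =>
    have h₁ := hrel (n + (s + 1)) ((X ^ (s + 1)) f) (by
      have := pow_mem_filtration hX hf (s + 1)
      rwa [show n + (s + 1) + 1 = n + 1 + (s + 1) by ring])
    have h₂ := hX _ _ ih
    have h₃ := (F (n + (s + 1))).sub_mem h₁ h₂
    convert h₃ using 1
    rw [pow_succ' X (s + 1), Module.End.mul_apply, map_sub, map_smul, ← Module.End.mul_apply X (X ^ s),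
      ← pow_succ' X s, fischerCoeff]
    module

theorem exists_decomp_of_filtration (hF : Monotone F) (hF0 : F 0 = ⊥)
    (hX : ∀ n, ∀ f ∈ F n, X f ∈ F (n + 1)) (hD : ∀ n, ∀ f ∈ F (n + 1), D f ∈ F n)
    (hrel : ∀ n, ∀ f ∈ F (n + 1), D (X f) + X (D f) + (2 * (n : ℝ) + 3) • f ∈ F n) (k : ℕ) :
    (∀ P ∈ F k, ∃ M : ℕ → V, (∀ s, M s ∈ F (k - s) ∧ D (M s) = 0) ∧
      P = ∑ s ∈ range k, (X ^ s) (M s)) ∧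
    (∀ R ∈ F (k - 1), ∃ q ∈ F k, D q = R) := by
  induction k with
  | zero =>
    simp only [hF0, Submodule.mem_bot, zero_tsub]
    refine ⟨?_, ?_⟩
    · rintro P rfl
      exact ⟨0, by simp, by simp⟩
    · rintro R rfl
      exact ⟨0, rfl, map_zero D⟩
  | succ k ih =>
    obtain ⟨hS, hT⟩ := ih
    have key : ∀ R ∈ F k, ∃ M : ℕ → V, (∀ s, M s ∈ F (k - s) ∧ D (M s) = 0) ∧
        D (∑ s ∈ range k, (X ^ (s + 1)) (M s)) - R ∈ F (k - 1) := by
      intro R hR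
      obtain ⟨M, hM, rfl⟩ := hS R hR
      refine ⟨fun s => (fischerCoeff (k - s - 1) (s + 1))⁻¹ • M s, fun s =>
        ⟨(F _).smul_mem _ (hM s).1, by rw [map_smul, (hM s).2, smul_zero]⟩, ?_⟩
      rw [map_sum, ← sum_sub_distrib]
      refine (F _).sum_mem fun s hs => ?_
      have hs := mem_range.1 hs
      have h₁ := apply_pow_sub_mem_filtration hX hrel (n := k - s - 1)
        (by have := (hM s).1; rwa [show k - s - 1 + 1 = k - s by omega]) (hM s).2 s
      have h₂ := (F _).smul_mem (fischerCoeff (k - s - 1) (s + 1))⁻¹ h₁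
      rw [show k - s - 1 + s = k - 1 by omega, smul_sub, smul_smul,
        inv_mul_cancel₀ (fischerCoeff_succ_ne_zero _ _), one_smul] at h₂
      simpa only [map_smul] using h₂
    have hmem : ∀ M : ℕ → V, (∀ s, M s ∈ F (k - s) ∧ D (M s) = 0) →
        ∑ s ∈ range k, (X ^ (s + 1)) (M s) ∈ F (k + 1) := by
      intro M hM
      refine (F _).sum_mem fun s hs => ?_
      have hs := mem_range.1 hs
      have := pow_mem_filtration hX (hM s).1 (s + 1)
      rwa [show k - s + (s + 1) = k + 1 by omega] at this
    refine ⟨fun P hP => ?_, fun R hR => ?_⟩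
    · obtain ⟨M, hM, hq⟩ := key (D P) (hD k P hP)
      obtain ⟨r, hr, hDr⟩ := hT _ hq
      obtain ⟨N, hN, hrN⟩ := hS r hr
      have hNk : N k = 0 := by simpa [hF0] using (hN k).1
      have hsum : r = N 0 + ∑ s ∈ range k, (X ^ (s + 1)) (N (s + 1)) := by
        have := sum_range_succ' (fun s => (X ^ s) (N s)) k
        rw [sum_range_succ, ← hrN, hNk, map_zero, add_zero] at this
        rw [this, add_comm]
        simp
      obtain ⟨M', hM0, hMsucc⟩ : ∃ M' : ℕ → V,
          M' 0 = P - ∑ s ∈ range k, (X ^ (s + 1)) (M s) + r - N 0 ∧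
          ∀ s, M' (s + 1) = M s - N (s + 1) :=
        ⟨fun s => Nat.casesOn s (P - ∑ s ∈ range k, (X ^ (s + 1)) (M s) + r - N 0)
          fun s => M s - N (s + 1), rfl, fun _ => rfl⟩
      refine ⟨M', ?_, ?_⟩
      · rintro (_ | s)
        · rw [hM0]
          refine ⟨(F _).sub_mem ((F _).add_mem ((F _).sub_mem hP (hmem M hM))
            (hF k.le_succ hr)) (hF (by omega) (hN 0).1), ?_⟩
          simp only [map_sub, map_add, hDr, (hN 0).2]
          abel
        · rw [hMsucc]
          refine ⟨(F _).sub_mem (hF (by omega) (hM s).1) (hF (by omega) (hN (s + 1)).1), ?_⟩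
          simp only [map_sub, (hM s).2, (hN (s + 1)).2, sub_zero]
      · rw [sum_range_succ']
        simp only [hM0, hMsucc, map_sub, sum_sub_distrib, pow_zero, Module.End.one_apply]
        nth_rewrite 1 [hsum]
        abel
    · obtain ⟨M, hM, hq⟩ := key R hR
      obtain ⟨r, hr, hDr⟩ := hT _ hq
      refine ⟨∑ s ∈ range k, (X ^ (s + 1)) (M s) - r,
        (F _).sub_mem (hmem M hM) (hF k.le_succ hr), ?_⟩
      rw [map_sub, hDr, sub_sub_cancel]

end FilteredModule

/-! ### The filtration of lattice functions by polynomial degree -/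

/-- Lattice polynomials with values in `ℍ` of degree less than `n`. -/
def piLt (b : Bool) (h : ℝ) (n : ℕ) : Submodule ℝ ((Fin 3 → ℤ) → ℍ[ℝ]) :=
  Submodule.span ℝ {f | ∃ (α : Fin 3 → ℕ) (a : ℍ[ℝ]),
    (∑ l, α l) < n ∧ f = fun m => mfp3 b h m α • a}

theorem piLt_succ (b : Bool) (h : ℝ) (n : ℕ) : piLt b h (n + 1) = PiLe3 b h n := by
  simp only [piLt, PiLe3, Nat.lt_succ_iff]

theorem piLt_zero (b : Bool) (h : ℝ) : piLt b h 0 = ⊥ := by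
  simp [piLt]

theorem piLt_mono (b : Bool) (h : ℝ) : Monotone (piLt b h) := by
  intro n k hnk
  refine Submodule.span_mono ?_
  rintro f ⟨α, a, hα, rfl⟩
  exact ⟨α, a, hα.trans_le hnk, rfl⟩

theorem mfp3_smul_mem_piLt {b : Bool} {h : ℝ} {n : ℕ} {α : Fin 3 → ℕ} (hα : ∑ l, α l < n)
    (a : ℍ[ℝ]) : (fun m => mfp3 b h m α • a) ∈ piLt b h n :=
  Submodule.subset_span ⟨α, a, hα, rfl⟩

theorem map_mem_of_mem_piLt {b : Bool} {h : ℝ} {n : ℕ}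
    (T : ((Fin 3 → ℤ) → ℍ[ℝ]) →ₗ[ℝ] ((Fin 3 → ℤ) → ℍ[ℝ]))
    (W : Submodule ℝ ((Fin 3 → ℤ) → ℍ[ℝ]))
    (hT : ∀ (α : Fin 3 → ℕ) (a : ℍ[ℝ]), ∑ l, α l < n → T (fun m => mfp3 b h m α • a) ∈ W)
    {f : (Fin 3 → ℤ) → ℍ[ℝ]} (hf : f ∈ piLt b h n) : T f ∈ W := by
  have : piLt b h n ≤ W.comap T := by
    refine Submodule.span_le.2 ?_
    rintro f ⟨α, a, hα, rfl⟩
    exact hT α a hα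
  exact this hf

theorem re_toQ (r : ℝ) (v : Fin 3 → ℝ) : (toQ r v).re = r := rfl

theorem imI_toQ (r : ℝ) (v : Fin 3 → ℝ) : (toQ r v).imI = v 0 := rfl

theorem imJ_toQ (r : ℝ) (v : Fin 3 → ℝ) : (toQ r v).imJ = v 1 := rfl

theorem imK_toQ (r : ℝ) (v : Fin 3 → ℝ) : (toQ r v).imK = v 2 := rfl

/-- The signed step: `h` for `b = true` and `-h` for `b = false`. -/
def step (b : Bool) (h : ℝ) : ℝ := (if b then 1 else -1) * h

/-- The partial difference `pd` as a linear map. -/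
def pdLin (σ : Bool) (h : ℝ) (l : Fin 3) :
    ((Fin 3 → ℤ) → ℍ[ℝ]) →ₗ[ℝ] ((Fin 3 → ℤ) → ℍ[ℝ]) where
  toFun := pd σ h l
  map_add' f g := by
    funext m
    cases σ <;> simp only [pd, Pi.add_apply, if_true, Bool.false_eq_true, if_false] <;> module
  map_smul' r f := by
    funext m
    cases σ <;>
      simp only [pd, Pi.smul_apply, if_true, Bool.false_eq_true, if_false, RingHom.id_apply] <;>
      module

/-- Multiplication by the coordinate `m_l h`. -/
def coordLin (h : ℝ) (l : Fin 3) :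
    ((Fin 3 → ℤ) → ℍ[ℝ]) →ₗ[ℝ] ((Fin 3 → ℤ) → ℍ[ℝ]) where
  toFun f m := ((m l : ℝ) * h) • f m
  map_add' f g := by funext m; simp
  map_smul' r f := by funext m; exact smul_comm ((m l : ℝ) * h) r (f m)

/-- Pointwise application of a real-linear endomorphism of `ℍ`. -/
def pointwiseLin (L : ℍ[ℝ] →ₗ[ℝ] ℍ[ℝ]) :
    ((Fin 3 → ℤ) → ℍ[ℝ]) →ₗ[ℝ] ((Fin 3 → ℤ) → ℍ[ℝ]) where
  toFun f m := L (f m)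
  map_add' f g := by funext m; simp
  map_smul' r f := by funext m; simp

theorem coordLin_apply (h : ℝ) (l : Fin 3) (f : (Fin 3 → ℤ) → ℍ[ℝ]) (m : Fin 3 → ℤ) :
    coordLin h l f m = ((m l : ℝ) * h) • f m := rfl

theorem pointwiseLin_apply (L : ℍ[ℝ] →ₗ[ℝ] ℍ[ℝ]) (f : (Fin 3 → ℤ) → ℍ[ℝ]) (m : Fin 3 → ℤ) :
    pointwiseLin L f m = L (f m) := rfl

/-- The imaginary units `i, j, k`. -/
def imUnit (l : Fin 3) : ℍ[ℝ] := toQ 0 (Pi.single l 1)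

/-- Left multiplication by an imaginary unit. -/
def unitLeftMul (l : Fin 3) : ℍ[ℝ] →ₗ[ℝ] ℍ[ℝ] := LinearMap.mulLeft ℝ (imUnit l)

theorem unitLeftMul_apply (l : Fin 3) (a : ℍ[ℝ]) : unitLeftMul l a = imUnit l * a := rfl

/-- The cross product with an imaginary unit, as half a commutator. -/
def crossUnit (l : Fin 3) : ℍ[ℝ] →ₗ[ℝ] ℍ[ℝ] :=
  (2⁻¹ : ℝ) • (unitLeftMul l - LinearMap.mulRight ℝ (imUnit l))

/-- Left multiplication by the pure quaternion `mh`. -/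
def vecLin (h : ℝ) : ((Fin 3 → ℤ) → ℍ[ℝ]) →ₗ[ℝ] ((Fin 3 → ℤ) → ℍ[ℝ]) :=
  ∑ l, pointwiseLin (unitLeftMul l) ∘ₗ coordLin h l

/-- The difference Dirac operator, `D_h^{−+}` for `b = true` and `D_h^{+−}` for `b = false`. -/
def diracLin (b : Bool) (h : ℝ) : ((Fin 3 → ℤ) → ℍ[ℝ]) →ₗ[ℝ] ((Fin 3 → ℤ) → ℍ[ℝ]) :=
  ∑ l, (pointwiseLin (unitLeftMul l) ∘ₗ pdLin (!b) h l +
    step b h • pointwiseLin (crossUnit l) ∘ₗ pdLin b h l ∘ₗ pdLin (!b) h l)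

theorem vecLin_eq_sum (h : ℝ) (f : (Fin 3 → ℤ) → ℍ[ℝ]) :
    vecLin h f = ∑ l, pointwiseLin (unitLeftMul l) (coordLin h l f) := by
  simp only [vecLin, LinearMap.sum_apply]
  rfl

theorem vecLin_apply (h : ℝ) (f : (Fin 3 → ℤ) → ℍ[ℝ]) (m : Fin 3 → ℤ) :
    vecLin h f m = vecQ3 h m * f m := by
  ext <;> simp [vecLin_eq_sum, pointwiseLin_apply, coordLin_apply, unitLeftMul_apply, vecQ3, imUnit, re_toQ, imI_toQ, imJ_toQ,
      imK_toQ, Fin.sum_univ_three] <;> ring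

theorem vecLin_pow_apply (h : ℝ) (s : ℕ) (f : (Fin 3 → ℤ) → ℍ[ℝ]) (m : Fin 3 → ℤ) :
    (vecLin h ^ s) f m = vecQ3 h m ^ s * f m := by
  induction s with
  | zero => simp
  | succ s ih => rw [pow_succ', Module.End.mul_apply, vecLin_apply, ih, pow_succ', mul_assoc]

theorem step_smul_pdLin_pdLin (b : Bool) {h : ℝ} (hh : h ≠ 0) (l : Fin 3)
    (f : (Fin 3 → ℤ) → ℍ[ℝ]) :
    step b h • pdLin b h l (pdLin (!b) h l f) = pdLin b h l f - pdLin (!b) h l f := by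
  have : h * h⁻¹ = 1 := mul_inv_cancel₀ hh
  funext m
  cases b <;>
    simp only [step, pdLin, pd, LinearMap.coe_mk, AddHom.coe_mk, Bool.not_true, Bool.not_false,
      Bool.false_eq_true, if_true, if_false, Pi.smul_apply, Pi.sub_apply, sub_add_cancel,
      add_sub_cancel_right, smul_smul, neg_mul, one_mul, this, neg_smul, one_smul]
  all_goals abel

theorem crossUnit_apply (l : Fin 3) (a : ℍ[ℝ]) :
    crossUnit l a = (2⁻¹ : ℝ) • (imUnit l * a - a * imUnit l) := rfl

theorem diracLin_apply (b : Bool) {h : ℝ} (hh : h ≠ 0) (f : (Fin 3 → ℤ) → ℍ[ℝ]) (m : Fin 3 → ℤ) :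
    diracLin b h f m = ∑ l, (imUnit l * pd (!b) h l f m +
      crossUnit l (pd b h l f m - pd (!b) h l f m)) := by
  simp only [diracLin, LinearMap.sum_apply, Finset.sum_apply]
  refine sum_congr rfl fun l _ => ?_
  have := congrFun (step_smul_pdLin_pdLin b hh l f) m
  simp only [Pi.smul_apply, Pi.sub_apply] at this
  change _ * _ + step b h • crossUnit l (pdLin b h l (pdLin (!b) h l f) m) = _
  rw [← map_smul, this]
  rfl

theorem diracLin_true {h : ℝ} (hh : h ≠ 0) (f : (Fin 3 → ℤ) → ℍ[ℝ]) :
    diracLin true h f = Dmp h f := by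
  funext m
  rw [diracLin_apply _ hh]
  ext <;>
    simp [Dmp, re_toQ, imI_toQ, imJ_toQ, imK_toQ,
      div3, grad3, curl3, vecf, pd, imUnit, crossUnit_apply, Fin.sum_univ_three] <;>
    ring

theorem diracLin_false {h : ℝ} (hh : h ≠ 0) (f : (Fin 3 → ℤ) → ℍ[ℝ]) :
    diracLin false h f = Dpm h f := by
  funext m
  rw [diracLin_apply _ hh]
  ext <;>
    simp [Dpm, re_toQ, imI_toQ, imJ_toQ, imK_toQ,
      div3, grad3, curl3, vecf, pd, imUnit, crossUnit_apply, Fin.sum_univ_three] <;>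
    ring

/-! ### Factorial powers -/

/-- The one-variable factorial power. -/
def factPow (b : Bool) (h : ℝ) (n : ℕ) (t : ℤ) : ℝ :=
  ∏ k ∈ range n, ((t : ℝ) * h + (if b then 1 else -1) * k * h)

theorem factPow_succ (b : Bool) (h : ℝ) (n : ℕ) (t : ℤ) :
    factPow b h (n + 1) t = ((t : ℝ) * h + n * step b h) * factPow b h n t := by
  rw [factPow, prod_range_succ, factPow, step]
  ring

theorem factPow_succ_sub (b : Bool) (h : ℝ) (n : ℕ) (t : ℤ) :
    factPow b h (n + 1) (t - if b then 1 else -1) =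
      ((t : ℝ) * h - step b h) * factPow b h n t := by
  rw [factPow, prod_range_succ', factPow, step, mul_comm]
  congr 1
  · cases b <;> simp <;> ring
  · refine prod_congr rfl fun k _ => ?_
    cases b <;> simp <;> ring

theorem mfp3_eq_mul (b : Bool) (h : ℝ) (m : Fin 3 → ℤ) (α : Fin 3 → ℕ) (l : Fin 3) :
    mfp3 b h m α = factPow b h (α l) (m l) * ∏ j ∈ univ.erase l, factPow b h (α j) (m j) :=
  (mul_prod_erase univ (fun j => factPow b h (α j) (m j)) (mem_univ l)).symm

theorem mfp3_add_single (b : Bool) (h : ℝ) (m : Fin 3 → ℤ) (α : Fin 3 → ℕ) (l : Fin 3) :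
    mfp3 b h m (α + Pi.single l 1) = ((m l : ℝ) * h + α l * step b h) * mfp3 b h m α := by
  rw [mfp3_eq_mul b h m _ l, mfp3_eq_mul b h m α l, Pi.add_apply, Pi.single_eq_same,
    factPow_succ, mul_assoc]
  congr 2
  refine prod_congr rfl fun j hj => ?_
  rw [Pi.add_apply, Pi.single_eq_of_ne (ne_of_mem_erase hj), add_zero]

theorem mfp3_shift_add_single (b : Bool) (h : ℝ) (m : Fin 3 → ℤ) (α : Fin 3 → ℕ) (l : Fin 3) :
    mfp3 b h (m - Pi.single l (if b then 1 else -1)) (α + Pi.single l 1) =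
      ((m l : ℝ) * h - step b h) * mfp3 b h m α := by
  rw [mfp3_eq_mul b h _ _ l, mfp3_eq_mul b h m α l, Pi.add_apply, Pi.sub_apply, Pi.single_eq_same,
    Pi.single_eq_same, factPow_succ_sub, mul_assoc]
  congr 2
  refine prod_congr rfl fun j hj => ?_
  have hj := ne_of_mem_erase hj
  rw [Pi.add_apply, Pi.sub_apply, Pi.single_eq_of_ne hj, Pi.single_eq_of_ne hj, add_zero, sub_zero]

theorem mfp3_shift_of_eq_zero (b : Bool) (h : ℝ) (m : Fin 3 → ℤ) {α : Fin 3 → ℕ} {l : Fin 3}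
    (hα : α l = 0) (t : ℤ) : mfp3 b h (m - Pi.single l t) α = mfp3 b h m α := by
  rw [mfp3_eq_mul b h _ _ l, mfp3_eq_mul b h m α l, hα]
  congr 1
  refine prod_congr rfl fun j hj => ?_
  rw [Pi.sub_apply, Pi.single_eq_of_ne (ne_of_mem_erase hj), sub_zero]

theorem pdLin_not_apply (b : Bool) (h : ℝ) (l : Fin 3) (f : (Fin 3 → ℤ) → ℍ[ℝ]) (m : Fin 3 → ℤ) :
    pdLin (!b) h l f m = (step b h)⁻¹ • (f m - f (m - Pi.single l (if b then 1 else -1))) := by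
  cases b
  · simp only [pdLin, pd, LinearMap.coe_mk, AddHom.coe_mk, step, Bool.not_false, if_true,
      Bool.false_eq_true, if_false, Pi.single_neg, sub_neg_eq_add, neg_mul, one_mul, inv_neg]
    module
  · simp [pdLin, pd, step]

theorem step_ne_zero (b : Bool) {h : ℝ} (hh : h ≠ 0) : step b h ≠ 0 := by
  cases b <;> simpa [step] using hh

theorem pdLin_mfp3_add_single (b : Bool) {h : ℝ} (hh : h ≠ 0) (l : Fin 3) (α : Fin 3 → ℕ)
    (a : ℍ[ℝ]) :
    pdLin (!b) h l (fun m => mfp3 b h m (α + Pi.single l 1) • a) =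
      ((α l : ℝ) + 1) • fun m => mfp3 b h m α • a := by
  funext m
  rw [pdLin_not_apply, mfp3_add_single, mfp3_shift_add_single, ← sub_smul, smul_smul, Pi.smul_apply,
    smul_smul]
  congr 1
  field_simp [step_ne_zero b hh]
  ring

theorem pdLin_mfp3_of_eq_zero (b : Bool) (h : ℝ) {l : Fin 3} {α : Fin 3 → ℕ} (hα : α l = 0)
    (a : ℍ[ℝ]) : pdLin (!b) h l (fun m => mfp3 b h m α • a) = 0 := by
  funext m
  rw [pdLin_not_apply, mfp3_shift_of_eq_zero b h m hα, sub_self, smul_zero, Pi.zero_apply]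

theorem coordLin_mfp3 (b : Bool) (h : ℝ) (l : Fin 3) (α : Fin 3 → ℕ) (a : ℍ[ℝ]) :
    coordLin h l (fun m => mfp3 b h m α • a) =
      (fun m => mfp3 b h m (α + Pi.single l 1) • a) -
        (α l * step b h) • fun m => mfp3 b h m α • a := by
  funext m
  rw [coordLin_apply, Pi.sub_apply, Pi.smul_apply, mfp3_add_single]
  module

theorem sum_add_single (α : Fin 3 → ℕ) (l : Fin 3) :
    ∑ j, (α + Pi.single l 1 : Fin 3 → ℕ) j = ∑ j, α j + 1 := by
  simp [sum_add_distrib]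

theorem eq_zero_or_exists_add_single (α : Fin 3 → ℕ) (l : Fin 3) :
    α l = 0 ∨ ∃ β : Fin 3 → ℕ, α = β + Pi.single l 1 := by
  refine (Nat.eq_zero_or_pos (α l)).imp_right fun hα => ⟨α - Pi.single l 1, ?_⟩
  funext j
  by_cases hj : j = l
  · subst hj
    simp
    omega
  · simp [hj]

/-! ### Action of the basic operators on the filtration -/

section Filtration

variable {b : Bool} {h : ℝ} {n : ℕ} {f : (Fin 3 → ℤ) → ℍ[ℝ]}

theorem pointwiseLin_mem_piLt (L : ℍ[ℝ] →ₗ[ℝ] ℍ[ℝ]) (hf : f ∈ piLt b h n) :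
    pointwiseLin L f ∈ piLt b h n := by
  refine map_mem_of_mem_piLt _ _ (fun α a hα => ?_) hf
  have : pointwiseLin L (fun m => mfp3 b h m α • a) = fun m => mfp3 b h m α • L a := by
    funext m
    exact map_smul L _ _
  rw [this]
  exact mfp3_smul_mem_piLt hα _

theorem coordLin_mem_piLt (l : Fin 3) (hf : f ∈ piLt b h n) :
    coordLin h l f ∈ piLt b h (n + 1) := by
  refine map_mem_of_mem_piLt _ _ (fun α a hα => ?_) hf
  rw [coordLin_mfp3]
  refine Submodule.sub_mem _ (mfp3_smul_mem_piLt ?_ _)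
    (Submodule.smul_mem _ _ (mfp3_smul_mem_piLt (by omega) _))
  rw [sum_add_single]
  omega

theorem pdLin_not_mem_piLt (hh : h ≠ 0) (l : Fin 3) (hf : f ∈ piLt b h (n + 1)) :
    pdLin (!b) h l f ∈ piLt b h n := by
  refine map_mem_of_mem_piLt _ _ (fun α a hα => ?_) hf
  obtain h0 | ⟨β, rfl⟩ := eq_zero_or_exists_add_single α l
  · rw [pdLin_mfp3_of_eq_zero b h h0]
    exact Submodule.zero_mem _
  · rw [pdLin_mfp3_add_single b hh]
    rw [sum_add_single] at hα
    exact Submodule.smul_mem _ _ (mfp3_smul_mem_piLt (by omega) _)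

theorem pdLin_mem_piLt (hh : h ≠ 0) (l : Fin 3) (hf : f ∈ piLt b h (n + 1)) :
    pdLin b h l f ∈ piLt b h n := by
  induction n generalizing f with
  | zero =>
    have h0 := pdLin_not_mem_piLt hh l hf
    have := step_smul_pdLin_pdLin b hh l f
    rw [piLt_zero, Submodule.mem_bot] at h0 ⊢
    simpa [h0] using this.symm
  | succ n ih =>
    have h₁ := pdLin_not_mem_piLt hh l hf
    rw [← sub_add_cancel (pdLin b h l f) (pdLin (!b) h l f), ← step_smul_pdLin_pdLin b hh]
    exact Submodule.add_mem _ (Submodule.smul_mem _ _ (piLt_mono b h n.le_succ (ih h₁))) h₁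

theorem vecLin_mem_piLt (hf : f ∈ piLt b h n) : vecLin h f ∈ piLt b h (n + 1) := by
  rw [vecLin_eq_sum]
  exact Submodule.sum_mem _ fun l _ => pointwiseLin_mem_piLt _ (coordLin_mem_piLt l hf)

theorem diracLin_mem_piLt (hh : h ≠ 0) (hf : f ∈ piLt b h (n + 1)) :
    diracLin b h f ∈ piLt b h n := by
  simp only [diracLin, LinearMap.sum_apply, LinearMap.add_apply, LinearMap.smul_apply,
    LinearMap.comp_apply]
  refine Submodule.sum_mem _ fun l _ => ?_
  have h₁ := pdLin_not_mem_piLt hh l hf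
  exact Submodule.add_mem _ (pointwiseLin_mem_piLt _ h₁) (Submodule.smul_mem _ _
    (pointwiseLin_mem_piLt _ (pdLin_mem_piLt hh l (piLt_mono b h n.le_succ h₁))))

theorem coordLin_pdLin_sub_mem_piLt (hh : h ≠ 0) (l : Fin 3) {α : Fin 3 → ℕ} (hα : ∑ j, α j ≤ n)
    (a : ℍ[ℝ]) :
    coordLin h l (pdLin (!b) h l fun m => mfp3 b h m α • a) -
      (α l : ℝ) • (fun m => mfp3 b h m α • a) ∈ piLt b h n := by
  obtain h0 | ⟨β, rfl⟩ := eq_zero_or_exists_add_single α l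
  · simp [pdLin_mfp3_of_eq_zero b h h0, h0]
  · rw [pdLin_mfp3_add_single b hh, map_smul, coordLin_mfp3]
    rw [sum_add_single] at hα
    convert Submodule.smul_mem _ (-((β l + 1) * (β l * step b h)) : ℝ)
      (mfp3_smul_mem_piLt (b := b) (h := h) (show ∑ j, β j < n by omega) a) using 1
    simp only [Pi.add_apply, Pi.single_eq_same, Nat.cast_add, Nat.cast_one]
    module

theorem euler_sub_mem_piLt (hh : h ≠ 0) (hf : f ∈ piLt b h (n + 1)) :
    ∑ l, coordLin h l (pdLin (!b) h l f) - (n : ℝ) • f ∈ piLt b h n := by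
  have := map_mem_of_mem_piLt (b := b) (h := h) (n := n + 1)
    (∑ l, coordLin h l ∘ₗ pdLin (!b) h l - (n : ℝ) • LinearMap.id) (piLt b h n) ?_ hf
  · simpa [LinearMap.sum_apply] using this
  intro α a hα
  simp only [LinearMap.sub_apply, LinearMap.sum_apply, LinearMap.comp_apply, LinearMap.smul_apply,
    LinearMap.id_apply]
  have h₁ := Submodule.sum_mem (piLt b h n) fun l (_ : l ∈ univ) =>
    coordLin_pdLin_sub_mem_piLt (b := b) hh l (Nat.lt_succ_iff.1 hα) a
  have h₂ : ((∑ l, α l : ℕ) - n : ℝ) • (fun m => mfp3 b h m α • a) ∈ piLt b h n := by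
    obtain h0 | h0 := (Nat.lt_succ_iff.1 hα).lt_or_eq
    · exact Submodule.smul_mem _ _ (mfp3_smul_mem_piLt h0 a)
    · simp [h0]
  convert Submodule.add_mem _ h₁ h₂ using 1
  rw [sum_sub_distrib, ← sum_smul, Nat.cast_sum]
  module

theorem vecQ3_sub_single (b : Bool) (h : ℝ) (l : Fin 3) (m : Fin 3 → ℤ) :
    vecQ3 h (m - Pi.single l (if b then 1 else -1)) = vecQ3 h m - step b h • imUnit l := by
  ext <;> fin_cases l <;> cases b <;>
    simp [vecQ3, imUnit, step, re_toQ, imI_toQ, imJ_toQ, imK_toQ] <;> ring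

theorem pdLin_vecLin (hh : h ≠ 0) (l : Fin 3) (m : Fin 3 → ℤ) :
    pdLin (!b) h l (vecLin h f) m = vecQ3 h m * pdLin (!b) h l f m +
      imUnit l * (f m - step b h • pdLin (!b) h l f m) := by
  have hc := step_ne_zero b hh
  rw [pdLin_not_apply, pdLin_not_apply, vecLin_apply, vecLin_apply, vecQ3_sub_single,
    smul_inv_smul₀ hc, sub_sub_cancel, sub_mul, smul_mul_assoc, mul_smul_comm, mul_sub, ← sub_add,
    smul_add, inv_smul_smul₀ hc]

theorem sum_imUnit_pdLin_vecLin (hh : h ≠ 0) :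
    ∑ l, pointwiseLin (unitLeftMul l) (pdLin (!b) h l (vecLin h f)) =
      -vecLin h (∑ l, pointwiseLin (unitLeftMul l) (pdLin (!b) h l f)) -
        (2 : ℝ) • ∑ l, coordLin h l (pdLin (!b) h l f) - (3 : ℝ) • f +
        step b h • ∑ l, pdLin (!b) h l f := by
  funext m
  simp only [Pi.add_apply, Pi.sub_apply, Pi.neg_apply, Pi.smul_apply, Finset.sum_apply,
    Fin.sum_univ_three, pointwiseLin_apply, unitLeftMul_apply, coordLin_apply, pdLin_vecLin hh,
    vecLin_apply]
  generalize pdLin (!b) h 0 f m = u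
  generalize pdLin (!b) h 1 f m = v
  generalize pdLin (!b) h 2 f m = w
  generalize f m = q
  ext <;> simp [imUnit, vecQ3, re_toQ, imI_toQ, imJ_toQ, imK_toQ] <;> ring

theorem anticommutator_mem_piLt (hh : h ≠ 0) (hf : f ∈ piLt b h (n + 1)) :
    diracLin b h (vecLin h f) + vecLin h (diracLin b h f) + (2 * (n : ℝ) + 3) • f ∈
      piLt b h n := by
  have hsplit : ∀ g, diracLin b h g =
      ∑ l, pointwiseLin (unitLeftMul l) (pdLin (!b) h l g) +
      step b h • ∑ l, pointwiseLin (crossUnit l) (pdLin b h l (pdLin (!b) h l g)) := by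
    intro g
    simp [diracLin, LinearMap.sum_apply, sum_add_distrib, smul_sum]
  have hpd := fun l => pdLin_not_mem_piLt hh l hf
  have h₁ : ∑ l, pointwiseLin (crossUnit l) (pdLin b h l (pdLin (!b) h l (vecLin h f))) ∈
      piLt b h n := Submodule.sum_mem _ fun l _ => pointwiseLin_mem_piLt _
    (pdLin_mem_piLt hh l (pdLin_not_mem_piLt hh l (vecLin_mem_piLt hf)))
  have h₂ : vecLin h (∑ l, pointwiseLin (crossUnit l) (pdLin b h l (pdLin (!b) h l f))) ∈
      piLt b h n := by
    cases n with
    | zero =>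
      simp only [piLt_zero, Submodule.mem_bot] at hpd
      simp [hpd]
    | succ n => exact vecLin_mem_piLt (Submodule.sum_mem _ fun l _ =>
        pointwiseLin_mem_piLt _ (pdLin_mem_piLt hh l (hpd l)))
  have h₃ := Submodule.sum_mem _ fun l (_ : l ∈ univ) => hpd l
  have h₄ := euler_sub_mem_piLt hh hf
  convert Submodule.add_mem _ (Submodule.smul_mem _ (step b h) (Submodule.add_mem _
    (Submodule.add_mem _ h₁ h₂) h₃)) (Submodule.smul_mem _ (-2 : ℝ) h₄) using 1
  rw [hsplit (vecLin h f), hsplit f, sum_imUnit_pdLin_vecLin hh, map_add, map_smul]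
  module

end Filtration

theorem exists_fischer_decomposition (b : Bool) {h : ℝ} (hh : h ≠ 0) (k : ℕ)
    (P : (Fin 3 → ℤ) → ℍ[ℝ]) (hP : P ∈ PiLe3 b h k) :
    ∃ M : ℕ → ((Fin 3 → ℤ) → ℍ[ℝ]),
      (∀ s ≤ k, M s ∈ PiLe3 b h (k - s) ∧ diracLin b h (M s) = 0) ∧
      P = fun m => ∑ s ∈ range (k + 1), (vecQ3 h m) ^ s * M s m := by
  rw [← piLt_succ] at hP
  obtain ⟨M, hM, hPM⟩ := (exists_decomp_of_filtration (F := piLt b h) (X := vecLin h)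
    (D := diracLin b h) (piLt_mono b h) (piLt_zero b h) (fun _ _ => vecLin_mem_piLt)
    (fun _ _ => diracLin_mem_piLt hh) (fun _ _ => anticommutator_mem_piLt hh) (k + 1)).1 P hP
  refine ⟨M, fun s hs => ⟨?_, (hM s).2⟩, ?_⟩
  · rw [← piLt_succ, ← Nat.sub_add_comm hs]
    exact (hM s).1
  · rw [hPM]
    funext m
    simp only [Finset.sum_apply, vecLin_pow_apply]

/-- Theorem 4.1 (Fischer decomposition for `D_h^{−+}` and `D_h^{+−}`): every `P ∈ Π_k^−`
(resp. `Π_k^+`) decomposes as `P = Σ_{s=0}^k (mh)^s M_s` with `M_s ∈ Π_{k−s}^−`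
(resp. `Π_{k−s}^+`) in the kernel of `D_h^{−+}` (resp. `D_h^{+−}`). -/
theorem fischer_decomposition_quaternionic (h : ℝ) (hh : 0 < h) (k : ℕ) :
    (∀ P ∈ PiLe3 true h k, ∃ M : ℕ → ((Fin 3 → ℤ) → ℍ[ℝ]),
      (∀ s ≤ k, M s ∈ PiLe3 true h (k - s) ∧ Dmp h (M s) = 0) ∧
      P = fun m => ∑ s ∈ range (k + 1), (vecQ3 h m) ^ s * M s m) ∧
    (∀ P ∈ PiLe3 false h k, ∃ M : ℕ → ((Fin 3 → ℤ) → ℍ[ℝ]),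
      (∀ s ≤ k, M s ∈ PiLe3 false h (k - s) ∧ Dpm h (M s) = 0) ∧
      P = fun m => ∑ s ∈ range (k + 1), (vecQ3 h m) ^ s * M s m) := by
  refine ⟨fun P hP => ?_, fun P hP => ?_⟩
  · simpa only [diracLin_true hh.ne'] using exists_fischer_decomposition true hh.ne' k P hP
  · simpa only [diracLin_false hh.ne'] using exists_fischer_decomposition false hh.ne' k P hP
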